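/- arXiv:0905.1282 — 4 statements merged into one kernel-verified Lean document; each statement's English description precedes it below -/
import Mathlib

section
/- Let G be the special HNN-extension G = ⟨A, t ∣ tht⁻¹ = h for all h ∈ H⟩ of a group A with respect to a subgroup H ≤ A, and let ψ: A → B be a group homomorphism. Then ψ extends to a homomorphism ψ̃: G → P, where P = ⟨B, s ∣ sxs⁻¹ = x for all x ∈ ψ(H)⟩, with ψ̃|_A = ψ and ψ̃(t) = s; moreover the kernel of ψ̃ equals the normal closure in G of ker(ψ). -/
/-- The special HNN-extension of a group `A` with respect to a subgroup `H ≤ A`: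
`⟨A, t ∣ tht⁻¹ = h, ∀ h ∈ H⟩`. -/
abbrev SpecialHNN {A : Type*} [Group A] (H : Subgroup A) :=
  HNNExtension A H H (MulEquiv.refl H)

theorem specialHNN_exists_map {C B : Type*} [Group C] [Group B] (K : Subgroup C) (L : Subgroup B)
    (f : C →* B) (h : ∀ c ∈ K, f c ∈ L) :
    ∃ F : SpecialHNN K →* SpecialHNN L,
      (∀ a : C, F (HNNExtension.of a) = HNNExtension.of (f a)) ∧
      F HNNExtension.t = HNNExtension.t := by
  refine ⟨HNNExtension.lift (HNNExtension.of.comp f) HNNExtension.t ?_, ?_, ?_⟩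
  · intro a
    exact HNNExtension.t_mul_of (φ := MulEquiv.refl L) ⟨f a, h a a.2⟩
  · intro a; exact HNNExtension.lift_of _ _ _ a
  · exact HNNExtension.lift_t _ _ _

theorem specialHNN_map_injective {C B : Type*} [Group C] [Group B]
    (K : Subgroup C) (L : Subgroup B)
    (f : C →* B) (hf : Function.Injective f) (h : ∀ c, f c ∈ L → c ∈ K)
    (F : SpecialHNN K →* SpecialHNN L)
    (hF : ∀ a : C, F (HNNExtension.of a) = HNNExtension.of (f a))
    (hFt : F HNNExtension.t = HNNExtension.t) (x : SpecialHNN K) (hx : F x = 1) : x = 1 := by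
  obtain ⟨d⟩ := HNNExtension.NormalWord.TransversalPair.nonempty C K K
  obtain ⟨w, rfl⟩ := (HNNExtension.NormalWord.equiv (MulEquiv.refl K) d).symm.surjective x
  change F (w.toReducedWord.prod (MulEquiv.refl K)) = 1 at hx
  change w.toReducedWord.prod (MulEquiv.refl K) = 1
  generalize w.toReducedWord = v at hx
  have key : ∀ u, ∀ c : C, f c ∈ HNNExtension.toSubgroup L L u →
      c ∈ HNNExtension.toSubgroup K K u := by
    intro u c hc
    simp only [HNNExtension.toSubgroup, ite_self] at hc ⊢
    exact h c hc
  let v' : HNNExtension.NormalWord.ReducedWord B L L :=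
    { head := f v.head
      toList := v.toList.map (fun p => (p.1, f p.2))
      chain := by
        rw [List.isChain_map]
        refine v.chain.imp ?_
        intro a b hab hm
        exact hab (key _ _ hm) }
  have hv' : v'.prod (MulEquiv.refl L) = F (v.prod (MulEquiv.refl K)) := by
    simp only [HNNExtension.NormalWord.ReducedWord.prod, v', map_mul, map_list_prod, List.map_map,
      hF]
    congr 2
    apply List.map_congr_left
    intro p _
    simp [hF, hFt]
  have hnil := HNNExtension.ReducedWord.toList_eq_nil_of_mem_of_range (MulEquiv.refl L) v'
    (by rw [hv', hx]; exact one_mem _)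
  have hl : v.toList = [] := by simpa [v'] using hnil
  simp only [HNNExtension.NormalWord.ReducedWord.prod, hl, List.map_nil, List.prod_nil,
    mul_one] at hx ⊢
  rw [hF] at hx
  have h1 : f v.head = 1 := HNNExtension.of_injective (φ := MulEquiv.refl L) (by rw [hx, map_one])
  have h2 : v.head = 1 := hf (by rw [h1, map_one])
  rw [h2, map_one]

/-- A homomorphism `ψ : A → B` extends to a homomorphism between the special
HNN-extensions of `A` w.r.t. `H` and of `B` w.r.t. `ψ(H)`, sending the stable
letter to the stable letter; its kernel is the normal closure of `ker ψ`. -/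
theorem specialHNN_extension_hom {A B : Type*} [Group A] [Group B]
    (H : Subgroup A) (ψ : A →* B) :
    ∃ ψt : SpecialHNN H →* SpecialHNN (H.map ψ),
      (∀ a : A, ψt (HNNExtension.of a) = HNNExtension.of (ψ a)) ∧
      ψt HNNExtension.t = HNNExtension.t ∧
      ψt.ker = Subgroup.normalClosure
        (HNNExtension.of '' ((ψ.ker : Subgroup A) : Set A)) := by
  obtain ⟨F, hF, hFt⟩ := specialHNN_exists_map H (H.map ψ) ψ
    (fun c hc => Subgroup.mem_map_of_mem ψ hc)
  refine ⟨F, hF, hFt, le_antisymm ?_ ?_⟩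
  · intro x hx
    set N := Subgroup.normalClosure
      ((HNNExtension.of : A →* SpecialHNN H) '' ((ψ.ker : Subgroup A) : Set A)) with hN
    obtain ⟨P, hP, hPt⟩ := specialHNN_exists_map H (H.map ψ.rangeRestrict) ψ.rangeRestrict
      (fun c hc => Subgroup.mem_map_of_mem _ hc)
    have hsub : ∀ c : ψ.range, ψ.range.subtype c ∈ H.map ψ ↔ c ∈ H.map ψ.rangeRestrict := by
      intro c
      simp only [Subgroup.mem_map, Subtype.ext_iff]
      rfl
    obtain ⟨I, hI, hIt⟩ := specialHNN_exists_map (H.map ψ.rangeRestrict) (H.map ψ)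
      ψ.range.subtype (fun c hc => (hsub c).2 hc)
    have hcomp : I.comp P = F := by
      apply HNNExtension.hom_ext
      · ext a
        simp [hI, hP, hF]
      · simp [hIt, hPt, hFt]
    have hPx : P x = 1 := by
      apply specialHNN_map_injective _ _ _ (Subgroup.subtype_injective _)
        (fun c => (hsub c).1) I hI hIt
      rw [← MonoidHom.comp_apply, hcomp]
      exact hx
    let g : A →* SpecialHNN H ⧸ N := (QuotientGroup.mk' N).comp HNNExtension.of
    have hg : ψ.rangeRestrict.ker ≤ g.ker := by
      intro a ha
      rw [MonoidHom.ker_rangeRestrict] at ha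
      rw [MonoidHom.mem_ker]
      exact (QuotientGroup.eq_one_iff _).2 (Subgroup.subset_normalClosure ⟨a, ha, rfl⟩)
    let s := ψ.rangeRestrict.liftOfRightInverse _
      (Function.rightInverse_surjInv ψ.rangeRestrict_surjective) ⟨g, hg⟩
    have hs : ∀ a, s (ψ.rangeRestrict a) = g a := fun a =>
      MonoidHom.liftOfRightInverse_comp_apply _ _ _ ⟨g, hg⟩ a
    let S : SpecialHNN (H.map ψ.rangeRestrict) →* SpecialHNN H ⧸ N :=
      HNNExtension.lift s (QuotientGroup.mk' N HNNExtension.t) (by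
        rintro ⟨_, a, ha, rfl⟩
        simp only [MulEquiv.refl_apply]
        rw [hs]
        simp only [g, MonoidHom.comp_apply, ← map_mul]
        congr 1
        exact HNNExtension.t_mul_of (φ := MulEquiv.refl H) ⟨a, ha⟩)
    have hS : S.comp P = QuotientGroup.mk' N := by
      apply HNNExtension.hom_ext
      · refine MonoidHom.ext fun a => ?_
        simp only [MonoidHom.comp_apply, hP, S, HNNExtension.lift_of, hs, g]
      · simp only [MonoidHom.comp_apply, hPt, S, HNNExtension.lift_t]
    rw [← QuotientGroup.ker_mk' N, MonoidHom.mem_ker, ← hS, MonoidHom.comp_apply, hPx, map_one]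
  · apply Subgroup.normalClosure_le_normal
    rintro _ ⟨a, ha, rfl⟩
    have ha' : ψ a = 1 := ha
    change F _ = 1
    rw [hF, ha', map_one]
end

section
/- Let G = ⟨A, t ∣ tht⁻¹ = h, ∀h ∈ H⟩ be a special HNN-extension, and let g = t^ε x ∈ G where ε is a nonzero integer and x ∈ H. Then the centralizer of g in G equals ⟨t⟩ × C_H(x); in particular C_G(t^ε) = ⟨t⟩ × H. -/
namespace SpecialHNNAux

open FreeGroup

theorem exists_zpow {α : Type*} (e : α) : ∀ {ε : ℤ}, ε ≠ 0 → ∃ (n : ℕ) (b : Bool),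
    (of e : FreeGroup α) ^ ε = mk (List.replicate (n + 1) (e, b)) := by
  have key : ∀ n : ℕ, (of e : FreeGroup α) ^ n = mk (List.replicate n (e, true)) := by
    intro n
    rw [of, pow_mk, List.flatten_replicate_singleton]
  intro ε hε
  rcases Int.eq_nat_or_neg ε with ⟨n, rfl | rfl⟩
  · obtain ⟨m, rfl⟩ := Nat.exists_eq_succ_of_ne_zero (n := n) (by simpa using hε)
    exact ⟨m, true, by rw [zpow_natCast, key]⟩
  · obtain ⟨m, rfl⟩ := Nat.exists_eq_succ_of_ne_zero (n := n) (by simpa using hε)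
    exact ⟨m, false, by rw [zpow_neg, zpow_natCast, key, inv_mk]; simp [invRev]⟩

theorem free_key {α : Type*} (e : α) (s : α → α) (hs : Function.Injective s) (hse : s e = e)
    (ε : ℤ) (hε : ε ≠ 0) : ∀ L : List (α × Bool), FreeGroup.IsReduced L →
    mk L * of e ^ ε = of e ^ ε * FreeGroup.map s (mk L) → ∃ k : ℤ, mk L = of e ^ k := by
  classical
  intro L
  induction L with
  | nil => intro _ _; exact ⟨0, by simp [one_eq_mk]⟩
  | cons p L ih =>
    intro hL heq
    obtain ⟨p, b'⟩ := p
    by_cases hp : p = e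
    · subst hp
      obtain ⟨k₁, hk₁⟩ : ∃ k : ℤ, (mk [(p, b')] : FreeGroup α) = of p ^ k := by
        cases b'
        · exact ⟨-1, by rw [zpow_neg_one]; rfl⟩
        · exact ⟨1, by rw [zpow_one]; rfl⟩
      have hm : (mk ((p, b') :: L) : FreeGroup α) = of p ^ k₁ * mk L := by
        rw [← hk₁, mul_mk]; rfl
      rw [hm, _root_.map_mul, map_zpow, map.of, hse, ← mul_assoc, ← zpow_add, add_comm, zpow_add,
        mul_assoc, mul_assoc] at heq
      obtain ⟨k, hk⟩ := ih (hL.infix ⟨[(p, b')], [], by simp⟩) (mul_left_cancel heq)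
      exact ⟨k₁ + k, by rw [hm, hk, zpow_add]⟩
    · exfalso
      obtain ⟨n, b, hn⟩ := exists_zpow e hε
      rw [hn, map.mk, mul_mk, mul_mk] at heq
      have hred : FreeGroup.IsReduced (List.replicate (n + 1) (e, b) ++
          ((p, b') :: L).map fun x => (s x.1, x.2)) := by
        unfold FreeGroup.IsReduced
        rw [List.isChain_append]
        refine ⟨List.isChain_replicate_of_rel _ (by simp), ?_, ?_⟩
        · rw [List.isChain_map]
          exact List.IsChain.imp (fun a b h h' => h (hs h')) hL
        · intro x hx y hy
          have hx' := List.mem_of_mem_getLast? hx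
          rw [List.mem_replicate] at hx'
          simp at hy
          subst hy
          rw [hx'.2]
          intro h
          simp only at h
          exact absurd (hs (h.symm.trans hse.symm)) hp
      have h2 := congrArg toWord heq
      rw [toWord_mk, toWord_mk, hred.reduce_eq] at h2
      have h3 := (reduce.red (L := (p, b') :: L ++ List.replicate (n + 1) (e, b))).sublist
      rw [h2] at h3
      have h4 := h3.eq_of_length (by simp; omega)
      simp [List.replicate_succ] at h4
      exact hp h4.1.1.symm

variable {A : Type*} [Group A] (H : Subgroup A)

/-- The permutation action of `A` on the free group on `A ⧸ H`. -/
def act : A →* MulAut (FreeGroup (A ⧸ H)) where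
  toFun a := freeGroupCongr (MulAction.toPerm a)
  map_one' := by
    apply MulEquiv.toMonoidHom_injective
    ext f; simp
  map_mul' a b := by
    apply MulEquiv.toMonoidHom_injective
    ext f; simp [mul_smul]

theorem act_apply (a : A) (f : FreeGroup (A ⧸ H)) :
    act H a f = FreeGroup.map (fun q : A ⧸ H => a • q) f := rfl

abbrev S := FreeGroup (A ⧸ H) ⋊[act H] A

abbrev base : A ⧸ H := ((1 : A) : A ⧸ H)

theorem smul_base (a : A) : a • base H = (a : A ⧸ H) := by
  simp [base]

theorem smul_base_of_mem {a : A} (h : a ∈ H) : a • base H = base H := by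
  rw [smul_base, QuotientGroup.eq]; simpa using h

def toS : SpecialHNN H →* S H :=
  HNNExtension.lift SemidirectProduct.inr (SemidirectProduct.inl (of (base H))) (by
    intro a
    ext
    · simp [act_apply, smul_base_of_mem H a.2]
    · simp)

theorem comm_t {h : A} (hh : h ∈ H) :
    HNNExtension.t (φ := MulEquiv.refl H) * HNNExtension.of h =
      HNNExtension.of h * HNNExtension.t :=
  HNNExtension.t_mul_of (φ := MulEquiv.refl H) ⟨h, hh⟩

def conjT : A ⧸ H → SpecialHNN H :=
  Quotient.lift (fun a => HNNExtension.of a * HNNExtension.t * (HNNExtension.of a)⁻¹) (by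
    intro a b hab
    have hab : a⁻¹ * b ∈ H := QuotientGroup.leftRel_apply.1 hab
    have := comm_t H hab
    obtain ⟨c, rfl⟩ : ∃ c, b = a * c := ⟨a⁻¹ * b, by group⟩
    simp only [inv_mul_cancel_left] at this
    simp only [_root_.map_mul, mul_inv_rev]
    rw [mul_assoc (HNNExtension.of a) (HNNExtension.of c), ← this]
    group)

def ofS : S H →* SpecialHNN H :=
  SemidirectProduct.lift (FreeGroup.lift (conjT H)) HNNExtension.of (by
    intro a
    ext q
    induction q using QuotientGroup.induction_on with
    | H z =>
      simp [act_apply]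
      change HNNExtension.of (a * z) * HNNExtension.t * (HNNExtension.of (a * z))⁻¹ =
        HNNExtension.of a * (HNNExtension.of z * HNNExtension.t * (HNNExtension.of z)⁻¹) *
          (HNNExtension.of a)⁻¹
      simp only [_root_.map_mul, mul_inv_rev]
      group)

theorem ofS_toS (c : SpecialHNN H) : ofS H (toS H c) = c := by
  have : (ofS H).comp (toS H) = MonoidHom.id _ := by
    apply HNNExtension.hom_ext
    · ext a; simp [ofS, toS]
    · simp [ofS, toS]
      change HNNExtension.of 1 * HNNExtension.t * (HNNExtension.of 1)⁻¹ = _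
      simp
  exact DFunLike.congr_fun this c

theorem toS_injective : Function.Injective (toS H) :=
  Function.LeftInverse.injective (ofS_toS H)

theorem toS_form (n : ℤ) (a : A) :
    toS H (HNNExtension.t ^ n * HNNExtension.of a) = ⟨of (base H) ^ n, a⟩ := by
  rw [_root_.map_mul, map_zpow]
  simp only [toS, HNNExtension.lift_t, HNNExtension.lift_of]
  rw [← map_zpow, ← SemidirectProduct.mk_eq_inl_mul_inr]

open Classical in
/-- exponent sum of the base letter -/
noncomputable def cnt : FreeGroup (A ⧸ H) →* Multiplicative ℤ :=
  FreeGroup.lift fun q => if q = base H then Multiplicative.ofAdd 1 else 1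

theorem cnt_act {x : A} (hx : x ∈ H) (f : FreeGroup (A ⧸ H)) : cnt H (act H x f) = cnt H f := by
  have : (cnt H).comp (act H x).toMonoidHom = cnt H := by
    ext q
    have : x • q = base H ↔ q = base H := by
      conv_lhs => rw [← smul_base_of_mem H hx]
      exact smul_left_cancel_iff x
    simp only [cnt, act_apply, MonoidHom.comp_apply, MulEquiv.coe_toMonoidHom, map.of, lift_apply_of]
    by_cases hq : q = base H
    · rw [if_pos hq, if_pos (this.2 hq)]
    · rw [if_neg hq, if_neg (fun h => hq (this.1 h))]
  exact DFunLike.congr_fun this f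

theorem main (x : A) (hx : x ∈ H) (ε : ℤ) (hε : ε ≠ 0) (c : SpecialHNN H) :
    c ∈ Subgroup.centralizer {HNNExtension.t ^ ε * HNNExtension.of x} ↔
        ∃ (n : ℤ) (h : A), h ∈ H ∧ h * x = x * h ∧
          c = HNNExtension.t ^ n * HNNExtension.of h := by
  classical
  rw [Subgroup.mem_centralizer_singleton_iff, ← (toS_injective H).eq_iff, _root_.map_mul (toS H) c, _root_.map_mul (toS H) _ c,
    toS_form]
  constructor
  · intro hc
    rcases hfa : toS H c with ⟨f, a⟩
    rw [hfa, SemidirectProduct.ext_iff] at hc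
    simp only [SemidirectProduct.mul_left, SemidirectProduct.mul_right, map_zpow] at hc
    obtain ⟨h1, h2⟩ := hc
    rw [act_apply, map.of, smul_base] at h1
    have ha : a ∈ H := by
      by_contra ha
      have hne : (a : A ⧸ H) ≠ base H := by
        intro h
        rw [eq_comm, QuotientGroup.eq] at h
        exact ha (by simpa using h)
      have h3 := congrArg (cnt H) h1
      rw [_root_.map_mul, _root_.map_mul, cnt_act H hx, map_zpow, map_zpow] at h3
      simp [cnt, hne] at h3
      exact hε (by simpa [← ofAdd_zsmul] using h3)
    have hb : (a : A ⧸ H) = base H := by rw [← smul_base, smul_base_of_mem H ha]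
    rw [hb] at h1
    obtain ⟨k, hk⟩ := free_key (base H) (fun q => x • q) (MulAction.injective x)
      (smul_base_of_mem H hx) ε hε f.toWord isReduced_toWord (by rw [mk_toWord]; exact h1)
    refine ⟨k, a, ha, h2, toS_injective H ?_⟩
    rw [toS_form, hfa, ← hk, mk_toWord]
  · rintro ⟨n, h, hh, hcomm, rfl⟩
    rw [toS_form]
    apply SemidirectProduct.ext
    · simp only [SemidirectProduct.mul_left, map_zpow]
      rw [act_apply, act_apply, map.of, map.of, smul_base_of_mem H hh, smul_base_of_mem H hx,
        ← zpow_add, ← zpow_add, add_comm]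
    · simpa only [SemidirectProduct.mul_right] using hcomm

end SpecialHNNAux

/-- In the special HNN-extension `G = ⟨A, t ∣ tht⁻¹ = h, ∀ h ∈ H⟩`, for `x ∈ H`
and `ε ≠ 0`, the centralizer of `g = t^ε x` is `⟨t⟩ × C_H(x)` (an internal direct
product, since `t` commutes with `H`); in particular `C_G(t^ε) = ⟨t⟩ × H`. -/
theorem specialHNN_centralizer {A : Type*} [Group A] (H : Subgroup A)
    (x : A) (hx : x ∈ H) (ε : ℤ) (hε : ε ≠ 0) :
    (∀ h ∈ H, HNNExtension.t (φ := MulEquiv.refl H) * HNNExtension.of h =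
      HNNExtension.of h * HNNExtension.t) ∧
    (∀ c : SpecialHNN H,
      c ∈ Subgroup.centralizer {HNNExtension.t ^ ε * HNNExtension.of x} ↔
        ∃ (n : ℤ) (h : A), h ∈ H ∧ h * x = x * h ∧
          c = HNNExtension.t ^ n * HNNExtension.of h) ∧
    (∀ c : SpecialHNN H,
      c ∈ Subgroup.centralizer {(HNNExtension.t (φ := MulEquiv.refl H)) ^ ε} ↔
        ∃ (n : ℤ) (h : A), h ∈ H ∧ c = HNNExtension.t ^ n * HNNExtension.of h) := by
  refine ⟨fun h hh => SpecialHNNAux.comm_t H hh, SpecialHNNAux.main H x hx ε hε, fun c => ?_⟩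
  have := SpecialHNNAux.main H 1 H.one_mem ε hε c
  simpa using this
end

section
/- Let G be a right angled Artin group on a finite graph Γ, let A be a conjugate of a special subgroup of G, and let K ≤ G be a subgroup such that K ∩ A has finite index in K. Then K ⊆ A. -/
/-- The commutation relators of a right angled Artin group on a graph `Γ`. -/
def raagRels (V : Type*) (Γ : SimpleGraph V) : Set (FreeGroup V) :=
  {r | ∃ u v : V, Γ.Adj u v ∧
    r = FreeGroup.of u * FreeGroup.of v * (FreeGroup.of u)⁻¹ * (FreeGroup.of v)⁻¹}

/-- The right angled Artin group associated to a graph `Γ`. -/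
abbrev RAAG (V : Type*) (Γ : SimpleGraph V) := PresentedGroup (raagRels V Γ)

namespace RaagAux

variable {V : Type*} (Γ : SimpleGraph V) (N : ℕ)

/-- Integer functions on words which are invariant under the allowed swaps, vanish on words of
length `> N` and vanish on words containing a square of a letter. -/
def P : Submodule ℤ (List V → ℤ) where
  carrier := {f | (∀ a b u v, Γ.Adj u v → f (a ++ u :: v :: b) = f (a ++ v :: u :: b)) ∧
    (∀ w, N < w.length → f w = 0) ∧ (∀ a b v, f (a ++ v :: v :: b) = 0)}
  add_mem' := by
    rintro f g ⟨h1, h2, h3⟩ ⟨k1, k2, k3⟩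
    refine ⟨fun a b u v h => ?_, fun w h => ?_, fun a b v => ?_⟩
    · simp [h1 a b u v h, k1 a b u v h]
    · simp [h2 w h, k2 w h]
    · simp [h3, k3]
  zero_mem' := by simp
  smul_mem' := by
    rintro c f ⟨h1, h2, h3⟩
    refine ⟨fun a b u v h => ?_, fun w h => ?_, fun a b v => ?_⟩
    · simp [h1 a b u v h]
    · simp [h2 w h]
    · simp [h3]

/-- Right translation by a letter. -/
def D (v : V) : Module.End ℤ (P Γ N) where
  toFun f := ⟨fun w => f.1 (w ++ [v]), by
    obtain ⟨f, h1, h2, h3⟩ := f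
    refine ⟨fun a b u v h => ?_, fun w h => ?_, fun a b v => ?_⟩
    · simpa using h1 a (b ++ [_]) u v h
    · exact h2 _ (by simp; omega)
    · simpa using h3 a (b ++ [_]) v⟩
  map_add' f g := by ext w; simp
  map_smul' c f := by ext w; simp

lemma D_apply (v : V) (f : P Γ N) (w : List V) : (D Γ N v f).1 w = f.1 (w ++ [v]) := rfl

lemma D_sq (v : V) : D Γ N v * D Γ N v = 0 := by
  ext f w
  simpa [D_apply] using f.2.2.2 w [] v

lemma D_comm {u v : V} (h : Γ.Adj u v) : D Γ N u * D Γ N v = D Γ N v * D Γ N u := by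
  ext f w
  simpa [D_apply] using f.2.1 w [] u v h

/-- The unit `1 + D v`. -/
def U (v : V) : (Module.End ℤ (P Γ N))ˣ where
  val := 1 + D Γ N v
  inv := 1 - D Γ N v
  val_inv := by
    have := D_sq Γ N v
    simp [mul_sub, add_mul, this]
  inv_val := by
    have := D_sq Γ N v
    simp [mul_add, sub_mul, this]

lemma U_zpow (v : V) (e : ℤ) :
    ((U Γ N v ^ e : (Module.End ℤ (P Γ N))ˣ) : Module.End ℤ (P Γ N)) = 1 + e • D Γ N v := by
  have h := D_sq Γ N v
  induction e using Int.induction_on with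
  | zero => simp
  | succ i ih =>
    rw [zpow_add_one, Units.val_mul, ih]
    change _ * (1 + D Γ N v) = _
    simp [mul_add, add_mul, add_smul, add_assoc]
    rw [mul_assoc, h, mul_zero]
  | pred i ih =>
    rw [zpow_sub_one, Units.val_mul, ih]
    change _ * (1 - D Γ N v) = _
    simp [mul_sub, add_mul, sub_smul, add_sub_assoc]
    rw [mul_assoc, h, mul_zero]

/-- The truncated Magnus representation. -/
noncomputable def rho : RAAG V Γ →* (Module.End ℤ (P Γ N))ˣ :=
  PresentedGroup.toGroup (f := U Γ N) (by
    rintro r ⟨u, v, h, rfl⟩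
    have hc := D_comm Γ N h
    have : U Γ N u * U Γ N v = U Γ N v * U Γ N u := by
      ext1
      change (1 + D Γ N u) * (1 + D Γ N v) = (1 + D Γ N v) * (1 + D Γ N u)
      simp only [mul_add, add_mul, hc, one_mul, mul_one]
      abel
    simp [this])

lemma rho_of (v : V) : rho Γ N (PresentedGroup.of v) = U Γ N v := by
  simp [rho]

/-- Value of a syllable word. -/
def val (L : List (V × ℤ)) : RAAG V Γ :=
  (L.map fun p => (PresentedGroup.of p.1 : RAAG V Γ) ^ p.2).prod

lemma exists_val (g : RAAG V Γ) : ∃ L, val Γ L = g := by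
  obtain ⟨x, rfl⟩ := PresentedGroup.mk_surjective _ g
  induction x using FreeGroup.induction_on with
  | C1 => exact ⟨[], by simp [val]⟩
  | of v => exact ⟨[(v, 1)], by simp [val]; rfl⟩
  | inv_of v _ => exact ⟨[(v, -1)], by simp [val]; rfl⟩
  | mul x y hx hy =>
    obtain ⟨L, hL⟩ := hx
    obtain ⟨L', hL'⟩ := hy
    exact ⟨L ++ L', by rw [map_mul, ← hL, ← hL']; simp [val]⟩

lemma rho_val_nil : ((rho Γ N (val Γ []) : (Module.End ℤ (P Γ N))ˣ) : Module.End ℤ (P Γ N)) = 1 := by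
  simp [val]

lemma rho_val_cons (p : V × ℤ) (L : List (V × ℤ)) :
    ((rho Γ N (val Γ (p :: L)) : (Module.End ℤ (P Γ N))ˣ) : Module.End ℤ (P Γ N)) =
      (1 + p.2 • D Γ N p.1) * (rho Γ N (val Γ L) : (Module.End ℤ (P Γ N))ˣ) := by
  rw [← U_zpow, ← Units.val_mul, ← rho_of, ← map_zpow, ← map_mul]
  simp [val]

/-- The filtration on the endomorphism ring. -/
def I (j : ℕ) : AddSubgroup (Module.End ℤ (P Γ N)) where
  carrier := {φ | ∀ k (f : P Γ N), (∀ w, N < w.length + k → f.1 w = 0) →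
    ∀ w, N < w.length + (k + j) → (φ f).1 w = 0}
  add_mem' := by
    intro a b ha hb k f hf w hw
    simp [ha k f hf w hw, hb k f hf w hw]
  zero_mem' := by intro k f hf w hw; simp
  neg_mem' := by
    intro a ha k f hf w hw
    simp [ha k f hf w hw]

variable {Γ N}

lemma I_mul {i j : ℕ} {a b : Module.End ℤ (P Γ N)} (ha : a ∈ I Γ N i) (hb : b ∈ I Γ N j) :
    a * b ∈ I Γ N (j + i) := by
  intro k f hf w hw
  exact ha (k + j) (b f) (hb k f hf) w (by omega)

lemma one_mem_I : (1 : Module.End ℤ (P Γ N)) ∈ I Γ N 0 := by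
  intro k f hf w hw
  exact hf w (by omega)

lemma I_mono {j : ℕ} {a : Module.End ℤ (P Γ N)} (ha : a ∈ I Γ N (j + 1)) : a ∈ I Γ N j :=
  fun k f hf w hw => ha k f hf w (by omega)

lemma D_mem (v : V) : D Γ N v ∈ I Γ N 1 := by
  intro k f hf w hw
  exact hf _ (by simp; omega)

lemma I_tf {j n : ℕ} (hn : n ≠ 0) {a : Module.End ℤ (P Γ N)} (ha : n • a ∈ I Γ N j) :
    a ∈ I Γ N j := by
  intro k f hf w hw
  have := ha k f hf w hw
  simpa [hn] using this

lemma I_top {a : Module.End ℤ (P Γ N)} (ha : a ∈ I Γ N (N + 1)) : a = 0 := by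
  ext f w
  exact ha 0 f (fun w hw => f.2.2.1 w (by omega)) w (by omega)

lemma rho_sub_one_mem (g : RAAG V Γ) : (rho Γ N g : Module.End ℤ (P Γ N)) - 1 ∈ I Γ N 1 := by
  obtain ⟨L, rfl⟩ := exists_val Γ g
  induction L with
  | nil => rw [rho_val_nil, sub_self]; exact zero_mem _
  | cons p L ih =>
    rw [rho_val_cons]
    generalize ((rho Γ N (val Γ L) : (Module.End ℤ (P Γ N))ˣ) : Module.End ℤ (P Γ N)) = x at ih ⊢
    have e : (1 + p.2 • D Γ N p.1) * x - 1 = (x - 1) + p.2 • (D Γ N p.1 * (x - 1))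
        + p.2 • D Γ N p.1 := by
      rw [add_mul, mul_sub, smul_mul_assoc, smul_sub]; simp; abel
    rw [e]
    exact add_mem (add_mem ih (zsmul_mem (I_mono (I_mul (D_mem _) ih)) _)) (zsmul_mem (D_mem _) _)

lemma pow_sub_one_mem {x : Module.End ℤ (P Γ N)} (hx : x - 1 ∈ I Γ N 1) (n : ℕ) :
    x ^ n - 1 ∈ I Γ N 1 := by
  induction n with
  | zero => simp [zero_mem]
  | succ n ih =>
    have e : x ^ (n + 1) - 1 = (x ^ n - 1) * (x - 1) + (x ^ n - 1) + (x - 1) := by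
      rw [pow_succ]; noncomm_ring
    rw [e]
    exact add_mem (add_mem (I_mono (I_mul ih hx)) ih) hx

lemma pow_diff {x y : Module.End ℤ (P Γ N)} (hx : x - 1 ∈ I Γ N 1) (hy : y - 1 ∈ I Γ N 1)
    {j : ℕ} (hc : x - y ∈ I Γ N j) (n : ℕ) : x ^ n - y ^ n - n • (x - y) ∈ I Γ N (j + 1) := by
  induction n with
  | zero => simp [zero_mem]
  | succ n ih =>
    have e : x ^ (n + 1) - y ^ (n + 1) - (n + 1) • (x - y) =
        (x ^ n - y ^ n - n • (x - y)) * (x - 1) + (x ^ n - y ^ n - n • (x - y))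
          + n • ((x - y) * (x - 1)) + (y ^ n - 1) * (x - y) := by
      rw [pow_succ, pow_succ, add_smul, ← smul_mul_assoc]
      generalize n • (x - y) = z
      noncomm_ring
    rw [e]
    refine add_mem (add_mem (add_mem (I_mono ?_) ih) (nsmul_mem ?_ n)) ?_
    · rw [add_comm]; exact I_mul ih hx
    · rw [add_comm]; exact I_mul hc hx
    · exact I_mul (pow_sub_one_mem hy n) hc

lemma root_unique {x y : Module.End ℤ (P Γ N)} (hx : x - 1 ∈ I Γ N 1) (hy : y - 1 ∈ I Γ N 1)
    {n : ℕ} (hn : n ≠ 0) (h : x ^ n = y ^ n) : x = y := by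
  have : ∀ j, x - y ∈ I Γ N j := by
    intro j
    induction j with
    | zero =>
      have : x - y = (x - 1) - (y - 1) := by abel
      rw [this]
      exact sub_mem (I_mono hx) (I_mono hy)
    | succ j ih =>
      have := pow_diff hx hy ih n
      rw [h, sub_self, zero_sub, neg_mem_iff] at this
      exact I_tf hn this
  exact sub_eq_zero.1 (I_top (this _))

lemma coeff (L : List (V × ℤ)) (f : P Γ N) (m : List V)
    (hf : ∀ w, w.length < m.length + L.length → f.1 w = 0) :
    ((rho Γ N (val Γ L) : Module.End ℤ (P Γ N)) f).1 m =
      (L.map Prod.snd).prod * f.1 (m ++ L.map Prod.fst) := by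
  induction L generalizing m with
  | nil => rw [rho_val_nil]; simp
  | cons p L ih =>
    rw [rho_val_cons]
    have h1 := ih m (fun w hw => hf w (by simp; omega))
    have h2 := ih (m ++ [p.1]) (fun w hw => hf w (by simp at hw ⊢; omega))
    rw [hf (m ++ L.map Prod.fst) (by simp), mul_zero] at h1
    simp only [List.append_assoc, List.singleton_append] at h2
    simp [D_apply, h1, h2, mul_assoc]

lemma of_comm {u v : V} (h : Γ.Adj u v) :
    Commute (PresentedGroup.of u : RAAG V Γ) (PresentedGroup.of v) := by
  have h1 : (PresentedGroup.mk (raagRels V Γ) (FreeGroup.of u * FreeGroup.of v *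
      (FreeGroup.of u)⁻¹ * (FreeGroup.of v)⁻¹)) = 1 :=
    PresentedGroup.one_of_mem ⟨u, v, h, rfl⟩
  simp only [map_mul, map_inv] at h1
  rw [mul_inv_eq_one, mul_inv_eq_iff_eq_mul] at h1
  exact h1

lemma swap_val {a b : List V} {u v : V} (h : Γ.Adj u v) (L : List (V × ℤ))
    (hL : L.map Prod.fst = a ++ u :: v :: b) :
    ∃ L' : List (V × ℤ), L'.map Prod.fst = a ++ v :: u :: b ∧ val Γ L' = val Γ L := by
  obtain ⟨A, B, rfl, rfl, hB1⟩ := List.map_eq_append_iff.1 hL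
  obtain ⟨⟨u', e⟩, B, rfl, rfl, hB2⟩ := List.map_eq_cons_iff.1 hB1
  obtain ⟨⟨v', e'⟩, B, rfl, rfl, rfl⟩ := List.map_eq_cons_iff.1 hB2
  refine ⟨A ++ (v', e') :: (u', e) :: B, by simp, ?_⟩
  have := ((of_comm h).zpow_zpow e e').eq
  simp only [val, List.map_append, List.map_cons, List.prod_append, List.prod_cons]
  rw [← mul_assoc (_ ^ e'), ← mul_assoc (_ ^ e), this]

lemma merge_val {a b : List V} {v : V} (L : List (V × ℤ))
    (hL : L.map Prod.fst = a ++ v :: v :: b) :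
    ∃ L' : List (V × ℤ), L'.length < L.length ∧ val Γ L' = val Γ L := by
  obtain ⟨A, B, rfl, rfl, hB1⟩ := List.map_eq_append_iff.1 hL
  obtain ⟨⟨u', e⟩, B, rfl, rfl, hB2⟩ := List.map_eq_cons_iff.1 hB1
  obtain ⟨⟨v', e'⟩, B, rfl, h, rfl⟩ := List.map_eq_cons_iff.1 hB2
  dsimp at h
  subst h
  refine ⟨A ++ (v', e + e') :: B, by simp, ?_⟩
  simp [val, zpow_add, mul_assoc]

open Classical in
lemma faithful (g : RAAG V Γ) (h : ∀ N, rho Γ N g = 1) : g = 1 := by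
  have hex : ∃ k, ∃ L, val Γ L = g ∧ L.length = k := by
    obtain ⟨L, hL⟩ := exists_val Γ g
    exact ⟨_, L, hL, rfl⟩
  obtain ⟨L, hL, hk⟩ := Nat.find_spec hex
  have hmin : ∀ L', val Γ L' = g → L.length ≤ L'.length := fun L' h' => by
    rw [hk]; exact Nat.find_min' hex ⟨L', h', rfl⟩
  clear hk
  let f : P Γ L.length := ⟨fun w => if w.length = L.length ∧
      ∃ L' : List (V × ℤ), L'.map Prod.fst = w ∧ val Γ L' = g then 1 else 0, by
    refine ⟨fun a b u v h => ?_, fun w h => ?_, fun a b v => ?_⟩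
    · have : ∀ u v, Γ.Adj u v → (∃ L' : List (V × ℤ), L'.map Prod.fst = a ++ u :: v :: b ∧
          val Γ L' = g) → (∃ L' : List (V × ℤ), L'.map Prod.fst = a ++ v :: u :: b ∧
          val Γ L' = g) := by
        rintro u v h ⟨L', h1, h2⟩
        obtain ⟨L'', h3, h4⟩ := swap_val h L' h1
        exact ⟨L'', h3, h4.trans h2⟩
      have h2 := Iff.intro (this u v h) (this v u h.symm)
      simp [h2]
    · exact if_neg (fun h' => by omega)
    · refine if_neg ?_
      rintro ⟨h1, L', h2, h3⟩
      obtain ⟨L'', h4, h5⟩ := merge_val (Γ := Γ) L' h2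
      have := hmin L'' (h5.trans h3)
      have h6 := congrArg List.length h2
      rw [List.length_map] at h6
      omega⟩
  have hc := coeff L f [] (fun w hw => if_neg (fun h' => by simp at hw; omega))
  rw [hL, h] at hc
  have hf : f.1 ([] ++ L.map Prod.fst) = 1 := if_pos ⟨by simp, L, by simp, hL⟩
  rw [hf, mul_one] at hc
  rcases Nat.eq_zero_or_pos L.length with h0 | h0
  · rw [List.length_eq_zero_iff] at h0
    subst h0
    simpa [val] using hL.symm
  · exfalso
    have hz : f.1 [] = 0 := if_neg (fun h' => by simp at h'; simp [← h'.1] at h0)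
    have hc' : (L.map Prod.snd).prod = 0 := by rw [← hc]; exact hz
    rw [List.prod_eq_zero_iff, List.mem_map] at hc'
    obtain ⟨⟨v, e⟩, hm, rfl⟩ := hc'
    obtain ⟨A, B, rfl⟩ := List.append_of_mem hm
    have := hmin (A ++ B) (by rw [← hL]; simp [val])
    simp at this

lemma raag_root_unique {x y : RAAG V Γ} {n : ℕ} (hn : n ≠ 0) (h : x ^ n = y ^ n) : x = y := by
  rw [← mul_inv_eq_one]
  refine faithful _ (fun N => ?_)
  rw [map_mul, map_inv, mul_inv_eq_one]
  ext1
  refine root_unique (rho_sub_one_mem x) (rho_sub_one_mem y) hn ?_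
  rw [← Units.val_pow_eq_pow_val, ← Units.val_pow_eq_pow_val, ← map_pow, ← map_pow, h]

open Classical in
/-- Retraction to a special subgroup. -/
noncomputable def retr (Γ : SimpleGraph V) (S : Set V) : RAAG V Γ →* RAAG V Γ :=
  PresentedGroup.toGroup (f := fun v => if v ∈ S then PresentedGroup.of v else 1) (by
    rintro r ⟨u, v, h, rfl⟩
    have := (of_comm h).eq
    by_cases hu : u ∈ S <;> by_cases hv : v ∈ S <;> simp [hu, hv, this])

lemma retr_mem (S : Set V) (x : RAAG V Γ) :
    retr Γ S x ∈ Subgroup.closure (PresentedGroup.of '' S) := by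
  obtain ⟨L, rfl⟩ := exists_val Γ x
  induction L with
  | nil => simp [val, one_mem]
  | cons p L ih =>
    have : val Γ (p :: L) = PresentedGroup.of p.1 ^ p.2 * val Γ L := by simp [val]
    rw [this, map_mul, map_zpow]
    refine mul_mem (zpow_mem ?_ _) ih
    by_cases hp : p.1 ∈ S
    · simpa [retr, hp] using Subgroup.subset_closure (Set.mem_image_of_mem _ hp)
    · simp [retr, hp, one_mem]

lemma retr_eq (S : Set V) {x : RAAG V Γ} (hx : x ∈ Subgroup.closure (PresentedGroup.of '' S)) :
    retr Γ S x = x := by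
  have : Subgroup.closure (PresentedGroup.of '' S) ≤ (retr Γ S).eqLocus (MonoidHom.id _) := by
    rw [Subgroup.closure_le]
    rintro _ ⟨v, hv, rfl⟩
    change retr Γ S _ = _
    simp [retr, hv]
  exact this hx

lemma mem_of_pow_mem (S : Set V) {x : RAAG V Γ} {n : ℕ} (hn : n ≠ 0)
    (hx : x ^ n ∈ Subgroup.closure (PresentedGroup.of '' S)) :
    x ∈ Subgroup.closure (PresentedGroup.of '' S) := by
  have h := retr_eq S hx
  rw [map_pow] at h
  rw [← raag_root_unique hn h]
  exact retr_mem S x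

end RaagAux

/-- If `A` is a conjugate of a special subgroup of a right angled Artin group `G`
(on a finite graph) and `K ∩ A` has finite index in a subgroup `K ≤ G`, then `K ⊆ A`. -/
theorem le_conjugate_special_of_finite_relindex {V : Type*} [Finite V]
    (Γ : SimpleGraph V) (A K : Subgroup (RAAG V Γ))
    (hA : ∃ (S : Set V) (g : RAAG V Γ),
      A = (Subgroup.closure (PresentedGroup.of '' S)).map (MulAut.conj g).toMonoidHom)
    (hK : (A.subgroupOf K).FiniteIndex) :
    K ≤ A := by
  obtain ⟨S, g, rfl⟩ := hA
  intro x hx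
  obtain ⟨n, hn, -, h⟩ := Subgroup.exists_pow_mem_of_index_ne_zero hK.index_ne_zero ⟨x, hx⟩
  rw [Subgroup.mem_subgroupOf] at h
  obtain ⟨y, hy, hyx⟩ := h
  refine ⟨g⁻¹ * x * g, ?_, by simp [mul_assoc]⟩
  refine RaagAux.mem_of_pow_mem S hn.ne' ?_
  have e : (g⁻¹ * x * g) ^ n = y := by
    have h1 : g * y * g⁻¹ = x ^ n := by simpa using hyx
    have h2 := conj_pow (i := n) (a := g⁻¹) (b := x)
    rw [inv_inv] at h2
    rw [h2, ← h1]
    group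
  rw [e]
  exact hy
end

section
/- Let H be a finitely generated subgroup of a finitely presented group G such that for every h ∈ H the H-conjugacy class h^H = {xhx⁻¹ : x ∈ H} is separable in G (closed in the profinite topology on G). Then the conjugacy problem for H is solvable: there is an algorithm deciding, given two words in the generators of H, whether they represent conjugate elements of H. -/
/-- A subset `S` of `G` is separable if it is closed in the profinite topology. -/
def SeparableIn {G : Type*} [Group G] (S : Set G) : Prop :=
  ∀ g ∉ S, ∃ N : Subgroup G, N.Normal ∧ N.FiniteIndex ∧ ∀ s ∈ S, g⁻¹ * s ∉ N

/-- Evaluation of a word (a list of signed letters) in a presented group. -/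
def evalWord {m : ℕ} {rels : Set (FreeGroup (Fin m))}
    (w : List (Fin m × Bool)) : PresentedGroup rels :=
  (w.map fun p => if p.2 then PresentedGroup.of p.1 else (PresentedGroup.of p.1)⁻¹).prod

namespace ConjProblem

section RE

/-- Projections of primitive recursive relations are recursively enumerable. -/
theorem rePred_exists {α β : Type*} [Primcodable α] [Primcodable β] {T : α × β → Prop}
    (hT : PrimrecPred T) : REPred fun a => ∃ b, T (a, b) := by
  classical
  have hd : Primrec fun x : α × β => decide (T x) := hT.decide
  have h1 : Primrec₂ fun (a : α) (k : ℕ) =>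
      ((Encodable.decode (α := β) k).map fun b => decide (T (a, b))).getD false := by
    refine Primrec.option_getD.comp ?_ (Primrec.const false)
    refine Primrec.option_map (Primrec.decode.comp Primrec.snd) ?_
    exact hd.comp (Primrec.pair (Primrec.fst.comp Primrec.fst) Primrec.snd)
  have h2 := (Partrec.rfind (p := fun a k => Part.some
    (((Encodable.decode (α := β) k).map fun b => decide (T (a, b))).getD false))
    h1.to_comp.partrec₂).dom_re
  refine h2.of_eq fun a => ?_
  refine Nat.rfind_dom'.trans ?_
  constructor
  · rintro ⟨k, hk, -⟩
    simp only [Part.mem_some_iff] at hk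
    cases hdec : Encodable.decode (α := β) k with
    | none => simp [hdec] at hk
    | some b => exact ⟨b, by simpa [hdec] using hk⟩
  · rintro ⟨b, hb⟩
    exact ⟨Encodable.encode b, by simp [hb], by simp⟩

end RE

section Words

variable {m : ℕ}

/-- Words. -/
abbrev Word (m : ℕ) := List (Fin m × Bool)

theorem primrec_reduce : Primrec (FreeGroup.reduce : Word m → Word m) := by
  have h : Primrec fun L : Word m => L.foldr (fun x acc =>
      (List.casesOn acc [x] fun hd tl =>
        if x.1 = hd.1 ∧ x.2 = not hd.2 then tl else x :: hd :: tl : Word m)) [] := by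
    refine Primrec.list_foldr (h := fun _ p => (List.casesOn p.2 [p.1] fun hd tl =>
        if p.1.1 = hd.1 ∧ p.1.2 = not hd.2 then tl else p.1 :: hd :: tl : Word m))
      Primrec.id (Primrec.const []) ?_
    refine Primrec.list_casesOn (f := fun q : Word m × ((Fin m × Bool) × Word m) => q.2.2)
      (g := fun q => [q.2.1])
      (h := fun q r => if q.2.1.1 = r.1.1 ∧ q.2.1.2 = not r.1.2 then r.2
        else q.2.1 :: r.1 :: r.2) (Primrec.snd.comp Primrec.snd) ?_ ?_
    · exact Primrec.list_cons.comp (Primrec.fst.comp Primrec.snd) (Primrec.const [])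
    · have hx : Primrec fun z : (Word m × ((Fin m × Bool) × Word m)) × ((Fin m × Bool) × Word m) =>
          z.1.2.1 := Primrec.fst.comp (Primrec.snd.comp Primrec.fst)
      have hy : Primrec fun z : (Word m × ((Fin m × Bool) × Word m)) × ((Fin m × Bool) × Word m) =>
          z.2.1 := Primrec.fst.comp Primrec.snd
      have ht : Primrec fun z : (Word m × ((Fin m × Bool) × Word m)) × ((Fin m × Bool) × Word m) =>
          z.2.2 := Primrec.snd.comp Primrec.snd
      refine Primrec.ite ?_ ht (Primrec.list_cons.comp hx (Primrec.list_cons.comp hy ht))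
      refine PrimrecPred.and ?_ ?_
      · exact Primrec.eq.comp (Primrec.fst.comp hx) (Primrec.fst.comp hy)
      · exact Primrec.eq.comp (Primrec.snd.comp hx) (Primrec.not.comp (Primrec.snd.comp hy))
  refine h.of_eq fun L => ?_
  induction L with
  | nil => rfl
  | cons x L ih => rw [List.foldr_cons, ih, FreeGroup.reduce.cons]

theorem primrec_invRev : Primrec (FreeGroup.invRev : Word m → Word m) := by
  unfold FreeGroup.invRev
  refine Primrec.list_reverse.comp (Primrec.list_map Primrec.id ?_)
  exact Primrec.pair (Primrec.fst.comp Primrec.snd) (Primrec.not.comp (Primrec.snd.comp Primrec.snd))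

/-- All letters of the word lie in `Y`. -/
def YWord (Y : Finset (Fin m)) (u : Word m) : Prop := ∀ p ∈ u, p.1 ∈ Y

theorem primrec_YWord (Y : Finset (Fin m)) : PrimrecPred (YWord Y) := by
  refine PrimrecPred.forall_mem_list (p := fun p : Fin m × Bool => p.1 ∈ Y) ?_
  exact Primrec.primrecPred (Primrec.dom_finite _)

theorem YWord.invRev {Y : Finset (Fin m)} {u : Word m} (h : YWord Y u) :
    YWord Y (FreeGroup.invRev u) := by
  intro p hp
  simp only [FreeGroup.invRev, List.mem_reverse, List.mem_map] at hp
  obtain ⟨q, hq, rfl⟩ := hp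
  exact h q hq

theorem YWord.append {Y : Finset (Fin m)} {u v : Word m} (h : YWord Y u) (h' : YWord Y v) :
    YWord Y (u ++ v) := by
  intro p hp
  rcases List.mem_append.1 hp with hp | hp
  exacts [h p hp, h' p hp]

theorem evalWord_eq {rels : Set (FreeGroup (Fin m))} (w : Word m) :
    (evalWord w : PresentedGroup rels) = PresentedGroup.mk rels (FreeGroup.mk w) := by
  have : PresentedGroup.mk rels = FreeGroup.lift (fun x => PresentedGroup.of x) := by
    ext x; simp [PresentedGroup.of]
  rw [this, FreeGroup.lift_mk]
  unfold evalWord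
  congr 2
  funext p
  cases p.2 <;> simp

theorem evalWord_append {rels : Set (FreeGroup (Fin m))} (u v : Word m) :
    (evalWord (u ++ v) : PresentedGroup rels) = evalWord u * evalWord v := by
  simp [evalWord]

theorem evalWord_invRev {rels : Set (FreeGroup (Fin m))} (u : Word m) :
    (evalWord (FreeGroup.invRev u) : PresentedGroup rels) = (evalWord u)⁻¹ := by
  rw [evalWord_eq, evalWord_eq, ← FreeGroup.inv_mk, map_inv]

theorem evalWord_surj {rels : Set (FreeGroup (Fin m))} (g : PresentedGroup rels) :
    ∃ u : Word m, evalWord u = g := by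
  obtain ⟨x, rfl⟩ := PresentedGroup.mk_surjective rels g
  exact ⟨x.toWord, by rw [evalWord_eq, FreeGroup.mk_toWord]⟩

theorem mem_closure_iff {rels : Set (FreeGroup (Fin m))} (Y : Finset (Fin m))
    (c : PresentedGroup rels) :
    c ∈ Subgroup.closure (PresentedGroup.of '' (↑Y : Set (Fin m))) ↔
      ∃ v : Word m, YWord Y v ∧ evalWord v = c := by
  constructor
  · intro hc
    induction hc using Subgroup.closure_induction with
    | mem x hx =>
      obtain ⟨y, hy, rfl⟩ := hx
      exact ⟨[(y, true)], by simpa [YWord] using hy, by simp [evalWord]⟩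
    | one => exact ⟨[], by simp [YWord], by simp [evalWord]⟩
    | mul x y _ _ ihx ihy =>
      obtain ⟨a, ha, rfl⟩ := ihx
      obtain ⟨b, hb, rfl⟩ := ihy
      exact ⟨a ++ b, ha.append hb, evalWord_append _ _⟩
    | inv x _ ih =>
      obtain ⟨a, ha, rfl⟩ := ih
      exact ⟨_, ha.invRev, evalWord_invRev _⟩
  · rintro ⟨v, hv, rfl⟩
    refine Subgroup.list_prod_mem _ ?_
    intro x hx
    obtain ⟨p, hp, rfl⟩ := List.mem_map.1 hx
    have h1 : (PresentedGroup.of p.1 : PresentedGroup rels) ∈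
        Subgroup.closure (PresentedGroup.of '' (↑Y : Set (Fin m))) :=
      Subgroup.subset_closure ⟨p.1, hv p hp, rfl⟩
    split_ifs
    exacts [h1, inv_mem h1]

end Words

section WordProblem

variable {m : ℕ} (R : Finset (FreeGroup (Fin m)))

/-- Relators and their inverses, as words. -/
noncomputable def relList : List (Word m) :=
  R.toList.map FreeGroup.toWord ++ R.toList.map fun r => FreeGroup.invRev r.toWord

/-- The product of conjugates of relators coded by `l`. -/
noncomputable def conjProd (l : List (Word m × ℕ)) : Word m :=
  l.flatMap fun p => p.1 ++ ((relList R).getD p.2 [] ++ FreeGroup.invRev p.1)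

theorem primrec_conjProd : Primrec (conjProd R) := by
  refine Primrec.list_flatMap Primrec.id ?_
  have h1 : Primrec fun z : List (Word m × ℕ) × (Word m × ℕ) => z.2.1 :=
    Primrec.fst.comp Primrec.snd
  have h2 : Primrec fun z : List (Word m × ℕ) × (Word m × ℕ) => z.2.2 :=
    Primrec.snd.comp Primrec.snd
  exact Primrec.list_append.comp h1 (Primrec.list_append.comp
    ((Primrec.list_getD []).comp (Primrec.const _) h2) (primrec_invRev.comp h1))

theorem mem_relList {r : Word m} (h : r ∈ relList R) :
    FreeGroup.mk r ∈ Subgroup.normalClosure (↑R : Set (FreeGroup (Fin m))) := by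
  rcases List.mem_append.1 h with h | h
  · obtain ⟨x, hx, rfl⟩ := List.mem_map.1 h
    rw [FreeGroup.mk_toWord]
    exact Subgroup.subset_normalClosure (by simpa using hx)
  · obtain ⟨x, hx, rfl⟩ := List.mem_map.1 h
    rw [← FreeGroup.inv_mk, FreeGroup.mk_toWord]
    exact inv_mem (Subgroup.subset_normalClosure (by simpa using hx))

theorem conjProd_mem (l : List (Word m × ℕ)) :
    FreeGroup.mk (conjProd R l) ∈ Subgroup.normalClosure (↑R : Set (FreeGroup (Fin m))) := by
  induction l with
  | nil => exact one_mem _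
  | cons p l ih =>
    have : FreeGroup.mk (conjProd R (p :: l)) = (FreeGroup.mk p.1 *
        FreeGroup.mk ((relList R).getD p.2 []) * (FreeGroup.mk p.1)⁻¹) *
        FreeGroup.mk (conjProd R l) := by
      simp [conjProd, FreeGroup.inv_mk]
    rw [this]
    refine mul_mem (Subgroup.normalClosure_normal.conj_mem _ ?_ _) ih
    by_cases hp : p.2 < (relList R).length
    · rw [List.getD_eq_getElem _ _ hp]
      exact mem_relList R (List.getElem_mem hp)
    · rw [List.getD_eq_default _ _ (not_lt.1 hp)]
      exact one_mem _

theorem exists_single {r : Word m} (h : r ∈ relList R) (a : Word m) :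
    ∃ p : Word m × ℕ, FreeGroup.mk (conjProd R [p]) =
      FreeGroup.mk a * FreeGroup.mk r * (FreeGroup.mk a)⁻¹ := by
  obtain ⟨k, hk, rfl⟩ := List.mem_iff_getElem.1 h
  refine ⟨(a, k), ?_⟩
  simp [conjProd, FreeGroup.inv_mk, List.getElem?_eq_getElem hk]

theorem conjProd_append (l l' : List (Word m × ℕ)) :
    FreeGroup.mk (conjProd R (l ++ l')) =
      FreeGroup.mk (conjProd R l) * FreeGroup.mk (conjProd R l') := by
  simp [conjProd]

theorem mem_normalClosure_iff (x : FreeGroup (Fin m)) :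
    x ∈ Subgroup.normalClosure (↑R : Set (FreeGroup (Fin m))) ↔
      ∃ l, x = FreeGroup.mk (conjProd R l) := by
  constructor
  · intro hx
    -- prove simultaneously for x and x⁻¹
    suffices h : (∃ l, x = FreeGroup.mk (conjProd R l)) ∧
        ∃ l, x⁻¹ = FreeGroup.mk (conjProd R l) from h.1
    unfold Subgroup.normalClosure at hx
    induction hx using Subgroup.closure_induction with
    | mem x hx =>
      obtain ⟨r, hr, hc⟩ := Group.mem_conjugatesOfSet_iff.1 hx
      obtain ⟨a, rfl⟩ := isConj_iff.1 hc
      have hr' : r ∈ R.toList := by simpa using hr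
      obtain ⟨p, hp⟩ := exists_single R (r := r.toWord)
        (List.mem_append_left _ (List.mem_map.2 ⟨r, hr', rfl⟩)) a.toWord
      obtain ⟨q, hq⟩ := exists_single R (r := FreeGroup.invRev r.toWord)
        (List.mem_append_right _ (List.mem_map.2 ⟨r, hr', rfl⟩)) a.toWord
      rw [← FreeGroup.inv_mk] at hq
      rw [FreeGroup.mk_toWord, FreeGroup.mk_toWord] at hp hq
      exact ⟨⟨_, hp.symm⟩, ⟨[q], by rw [hq]; group⟩⟩
    | one => exact ⟨⟨[], rfl⟩, ⟨[], by rw [inv_one]; rfl⟩⟩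
    | mul x y _ _ ihx ihy =>
      obtain ⟨⟨a, ha⟩, ⟨a', ha'⟩⟩ := ihx
      obtain ⟨⟨b, hb⟩, ⟨b', hb'⟩⟩ := ihy
      exact ⟨⟨a ++ b, by rw [conjProd_append, ha, hb]⟩,
        ⟨b' ++ a', by rw [conjProd_append, mul_inv_rev, ha', hb']⟩⟩
    | inv x _ ih => exact ⟨ih.2, by rw [inv_inv]; exact ih.1⟩
  · rintro ⟨l, rfl⟩
    exact conjProd_mem R l

theorem evalWord_eq_iff (u v : Word m) :
    (evalWord u : PresentedGroup (↑R : Set (FreeGroup (Fin m)))) = evalWord v ↔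
      ∃ l, FreeGroup.reduce (FreeGroup.invRev u ++ v) = FreeGroup.reduce (conjProd R l) := by
  have h : (evalWord u : PresentedGroup (↑R : Set (FreeGroup (Fin m)))) = evalWord v ↔
      (FreeGroup.mk u)⁻¹ * FreeGroup.mk v ∈
        Subgroup.normalClosure (↑R : Set (FreeGroup (Fin m))) := by
    rw [evalWord_eq, evalWord_eq]
    exact QuotientGroup.eq
  rw [h, mem_normalClosure_iff]
  refine exists_congr fun l => ?_
  rw [FreeGroup.inv_mk, FreeGroup.mul_mk]
  exact ⟨FreeGroup.reduce.sound, FreeGroup.reduce.exact⟩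

/-- Conjugacy of two words in the letters `Y`, via elements of the subgroup they generate. -/
def Good (Y : Finset (Fin m)) (x : Word m × Word m) : Prop :=
  YWord Y x.1 ∧ YWord Y x.2 ∧
    ∃ c ∈ Subgroup.closure (PresentedGroup.of '' (↑Y : Set (Fin m))),
      (evalWord x.1 : PresentedGroup (↑R : Set (FreeGroup (Fin m)))) = c * evalWord x.2 * c⁻¹

theorem re_good (Y : Finset (Fin m)) : REPred (Good R Y) := by
  have h := rePred_exists (α := Word m × Word m) (β := Word m × List (Word m × ℕ))
    (T := fun z => YWord Y z.1.1 ∧ YWord Y z.1.2 ∧ YWord Y z.2.1 ∧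
      FreeGroup.reduce (FreeGroup.invRev z.1.1 ++ (z.2.1 ++ (z.1.2 ++ FreeGroup.invRev z.2.1))) =
        FreeGroup.reduce (conjProd R z.2.2)) (by
    have hu : Primrec fun z : (Word m × Word m) × (Word m × List (Word m × ℕ)) => z.1.1 :=
      Primrec.fst.comp Primrec.fst
    have hw : Primrec fun z : (Word m × Word m) × (Word m × List (Word m × ℕ)) => z.1.2 :=
      Primrec.snd.comp Primrec.fst
    have hc : Primrec fun z : (Word m × Word m) × (Word m × List (Word m × ℕ)) => z.2.1 :=
      Primrec.fst.comp Primrec.snd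
    have hl : Primrec fun z : (Word m × Word m) × (Word m × List (Word m × ℕ)) => z.2.2 :=
      Primrec.snd.comp Primrec.snd
    refine ((primrec_YWord Y).comp hu).and (((primrec_YWord Y).comp hw).and
      (((primrec_YWord Y).comp hc).and ?_))
    refine Primrec.eq.comp (primrec_reduce.comp ?_) (primrec_reduce.comp
      ((primrec_conjProd R).comp hl))
    exact Primrec.list_append.comp (primrec_invRev.comp hu) (Primrec.list_append.comp hc
      (Primrec.list_append.comp hw (primrec_invRev.comp hc))))
  refine h.of_eq ?_
  rintro ⟨u, w⟩
  constructor
  · rintro ⟨⟨c, l⟩, hu, hw, hc, he⟩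
    refine ⟨hu, hw, evalWord c, (mem_closure_iff Y _).2 ⟨c, hc, rfl⟩, ?_⟩
    have := (evalWord_eq_iff R _ _).2 ⟨l, he⟩
    rw [this, evalWord_append, evalWord_append, evalWord_invRev, mul_assoc]
  · rintro ⟨hu, hw, c, hc, he⟩
    obtain ⟨v, hv, rfl⟩ := (mem_closure_iff Y _).1 hc
    rw [← evalWord_invRev, mul_assoc, ← evalWord_append, ← evalWord_append,
      evalWord_eq_iff] at he
    obtain ⟨l, hl⟩ := he
    exact ⟨(v, l), hu, hw, hv, hl⟩

end WordProblem

section Finite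

variable {m : ℕ}

/-- Transition of a letter on a state, coded by a table. -/
def step (n : ℕ) (d : List (List ℕ)) (x : Fin m × Bool) (i : ℕ) : ℕ :=
  ((d.getD (Encodable.encode x) []).getD i 0) % (n + 1)

/-- Transition of a word. -/
def act (n : ℕ) (d : List (List ℕ)) (w : Word m) (i : ℕ) : ℕ :=
  w.foldr (fun x i => step n d x i) i

/-- The table of a word. -/
def rho (c : ℕ × List (List ℕ)) (w : Word m) : List ℕ :=
  (List.range (c.1 + 1)).map (act c.1 c.2 w)

theorem primrec_rho : Primrec₂ (rho (m := m)) := by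
  refine Primrec.list_map (f := fun z : (ℕ × List (List ℕ)) × Word m => List.range (z.1.1 + 1))
    (g := fun z i => act z.1.1 z.1.2 z.2 i)
    (Primrec.list_range.comp (Primrec.succ.comp (Primrec.fst.comp Primrec.fst))) ?_
  refine Primrec.list_foldr
    (f := fun y : ((ℕ × List (List ℕ)) × Word m) × ℕ => y.1.2) (g := fun y => y.2)
    (h := fun y q => step y.1.1.1 y.1.1.2 q.1 q.2)
    (Primrec.snd.comp Primrec.fst) Primrec.snd ?_
  have h1 : Primrec fun t : (((ℕ × List (List ℕ)) × Word m) × ℕ) × ((Fin m × Bool) × ℕ) =>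
    t.1.1.1 := Primrec.fst.comp (Primrec.fst.comp Primrec.fst)
  have hq1 : Primrec fun t : (((ℕ × List (List ℕ)) × Word m) × ℕ) × ((Fin m × Bool) × ℕ) =>
    t.2.1 := Primrec.fst.comp Primrec.snd
  have hq2 : Primrec fun t : (((ℕ × List (List ℕ)) × Word m) × ℕ) × ((Fin m × Bool) × ℕ) =>
    t.2.2 := Primrec.snd.comp Primrec.snd
  exact Primrec.nat_mod.comp ((Primrec.list_getD 0).comp ((Primrec.list_getD []).comp
    (Primrec.snd.comp h1) (Primrec.encode.comp hq1)) hq2)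
    (Primrec.succ.comp (Primrec.fst.comp h1))

variable (R : Finset (FreeGroup (Fin m)))

/-- The words that have to act trivially. -/
noncomputable def trivList : List (Word m) :=
  R.toList.map FreeGroup.toWord ++
    (Finset.univ : Finset (Fin m × Bool)).toList.map fun x => [x, (x.1, !x.2)]

theorem rho_eq_iff {n : ℕ} {d : List (List ℕ)} {G : Type*} [Group G]
    (φ : G →* Equiv.Perm (Fin (n + 1))) (ev : Word m → G)
    (h : ∀ (w : Word m) (i : Fin (n + 1)), act n d w i = φ (ev w) i) (a b : Word m) :
    rho (n, d) a = rho (n, d) b ↔ φ (ev a) = φ (ev b) := by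
  unfold rho
  rw [List.map_inj_left]
  constructor
  · intro H
    ext i
    rw [← h, ← h]
    exact H i (List.mem_range.2 i.2)
  · intro H i hi
    have := h a ⟨i, by simpa using hi⟩
    have h' := h b ⟨i, by simpa using hi⟩
    simp only at this h'
    rw [this, h', H]

theorem sound {n : ℕ} {d : List (List ℕ)}
    (hv : ∀ r ∈ trivList R, rho (n, d) r = List.range (n + 1)) :
    ∃ φ : PresentedGroup (↑R : Set (FreeGroup (Fin m))) →* Equiv.Perm (Fin (n + 1)),
      ∀ (w : Word m) (i : Fin (n + 1)), act n d w i = φ (evalWord w) i := by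
  have htriv : ∀ r ∈ trivList R, ∀ i : Fin (n + 1), act n d r i = i := by
    intro r hr i
    have h1 : (rho (n, d) r)[(i : ℕ)]? = (List.range (n + 1))[(i : ℕ)]? := by rw [hv r hr]
    rw [rho, List.getElem?_map, List.getElem?_range i.2] at h1
    simpa using h1
  have hpair : ∀ (x : Fin m × Bool) (i : Fin (n + 1)),
      step n d x (step n d (x.1, !x.2) i) = i := by
    intro x i
    exact htriv [x, (x.1, !x.2)] (List.mem_append_right _ (List.mem_map.2 ⟨x, by simp, rfl⟩)) i
  have hlt : ∀ (x : Fin m × Bool) (i : ℕ), step n d x i < n + 1 :=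
    fun x i => Nat.mod_lt _ (Nat.succ_pos n)
  let f : Fin m → Equiv.Perm (Fin (n + 1)) := fun a =>
    { toFun := fun i => ⟨step n d (a, true) i, hlt _ _⟩
      invFun := fun i => ⟨step n d (a, false) i, hlt _ _⟩
      left_inv := fun i => Fin.ext (hpair (a, false) i)
      right_inv := fun i => Fin.ext (hpair (a, true) i) }
  have hact : ∀ (w : Word m) (i : Fin (n + 1)),
      act n d w i = FreeGroup.lift f (FreeGroup.mk w) i := by
    intro w i
    rw [FreeGroup.lift_mk]
    induction w with
    | nil => simp [act]
    | cons x w ih =>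
      have : act n d (x :: w) i = step n d x (act n d w i) := rfl
      rw [this, ih, List.map_cons, List.prod_cons, Equiv.Perm.mul_apply]
      obtain ⟨a, b⟩ := x
      cases b <;> rfl
  have hrel : ∀ r ∈ (↑R : Set (FreeGroup (Fin m))), FreeGroup.lift f r = 1 := by
    intro r hr
    ext i
    have h1 := hact r.toWord i
    rw [FreeGroup.mk_toWord] at h1
    rw [← h1, htriv r.toWord (List.mem_append_left _ (List.mem_map.2 ⟨r, by simpa using hr, rfl⟩))]
    rfl
  refine ⟨PresentedGroup.toGroup hrel, fun w i => ?_⟩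
  rw [hact, evalWord_eq]
  rfl

theorem complete {n : ℕ}
    (φ : PresentedGroup (↑R : Set (FreeGroup (Fin m))) →* Equiv.Perm (Fin (n + 1))) :
    ∃ d : List (List ℕ), (∀ r ∈ trivList R, rho (n, d) r = List.range (n + 1)) ∧
      ∀ (w : Word m) (i : Fin (n + 1)), act n d w i = φ (evalWord w) i := by
  obtain ⟨K, hK⟩ : ∃ K, ∀ x : Fin m × Bool, Encodable.encode x < K := by
    refine ⟨(Finset.univ.sup fun x : Fin m × Bool => Encodable.encode x) + 1, fun x => ?_⟩
    exact Nat.lt_succ_of_le (Finset.le_sup (f := fun x : Fin m × Bool => Encodable.encode x)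
      (Finset.mem_univ x))
  let row : Fin m × Bool → List ℕ := fun x =>
    List.ofFn fun i : Fin (n + 1) => (φ (evalWord [x]) i : ℕ)
  let d : List (List ℕ) := (List.range K).map fun k =>
    ((Encodable.decode (α := Fin m × Bool) k).map row).getD []
  have hrow : ∀ x, d.getD (Encodable.encode x) [] = row x := by
    intro x
    rw [List.getD_eq_getElem?_getD, List.getElem?_map, List.getElem?_range (hK x),
      Option.map_some, Option.getD_some, Encodable.encodek]
    rfl
  have hstep : ∀ (x : Fin m × Bool) (i : Fin (n + 1)), step n d x i = φ (evalWord [x]) i := by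
    intro x i
    unfold step
    rw [hrow]
    have h1 : (row x).getD (i : ℕ) 0 = φ (evalWord [x]) i := by
      rw [List.getD_eq_getElem _ _ (by simpa [row] using Nat.lt_succ_iff.1 i.2)]
      simp only [row, List.getElem_ofFn]
    rw [h1]
    exact Nat.mod_eq_of_lt (Fin.is_lt _)
  have hact : ∀ (w : Word m) (i : Fin (n + 1)), act n d w i = φ (evalWord w) i := by
    intro w i
    induction w with
    | nil => simp [act, evalWord]
    | cons x w ih =>
      have : act n d (x :: w) i = step n d x (act n d w i) := rfl
      rw [this, ih, hstep, ← Equiv.Perm.mul_apply, ← map_mul, ← evalWord_append]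
      rfl
  refine ⟨d, fun r hr => ?_, hact⟩
  have h0 : rho (n, d) ([] : Word m) = List.range (n + 1) := by
    exact List.map_id _
  rw [← h0, rho_eq_iff φ _ hact]
  congr 1
  rcases List.mem_append.1 hr with hr | hr
  · obtain ⟨x, hx, rfl⟩ := List.mem_map.1 hr
    rw [evalWord_eq, FreeGroup.mk_toWord, evalWord_eq]
    have : PresentedGroup.mk (↑R : Set (FreeGroup (Fin m))) x = 1 :=
      (QuotientGroup.eq_one_iff x).2 (Subgroup.subset_normalClosure (by simpa using hx))
    rw [this]
    exact (map_one _).symm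
  · obtain ⟨⟨a, b⟩, hx, rfl⟩ := List.mem_map.1 hr
    cases b <;> simp [evalWord]

/-- Letters over `Y`. -/
noncomputable def yLetters (Y : Finset (Fin m)) : List (Fin m × Bool) :=
  (Y ×ˢ (Finset.univ : Finset Bool)).toList

/-- A certificate of non-conjugacy. -/
def NegCert (Y : Finset (Fin m)) (x : Word m × Word m)
    (c : (ℕ × List (List ℕ)) × List (Word m)) : Prop :=
  (∀ r ∈ trivList R, rho c.1 r = List.range (c.1.1 + 1)) ∧
  (∃ s ∈ c.2, rho c.1 s = rho c.1 x.2) ∧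
  (∀ s ∈ c.2, ∀ y ∈ yLetters Y, ∃ s' ∈ c.2, rho c.1 s' = rho c.1 (y :: (s ++ [(y.1, !y.2)]))) ∧
  ∀ s ∈ c.2, ¬ rho c.1 s = rho c.1 x.1

set_option maxHeartbeats 2000000 in
theorem primrec_negCert (Y : Finset (Fin m)) :
    PrimrecPred fun z : (Word m × Word m) × ((ℕ × List (List ℕ)) × List (Word m)) =>
      NegCert R Y z.1 z.2 := by
  have hc : Primrec fun z : (Word m × Word m) × ((ℕ × List (List ℕ)) × List (Word m)) =>
    z.2.1 := Primrec.fst.comp Primrec.snd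
  have hS : Primrec fun z : (Word m × Word m) × ((ℕ × List (List ℕ)) × List (Word m)) =>
    z.2.2 := Primrec.snd.comp Primrec.snd
  have hu : Primrec fun z : (Word m × Word m) × ((ℕ × List (List ℕ)) × List (Word m)) =>
    z.1.1 := Primrec.fst.comp Primrec.fst
  have hw : Primrec fun z : (Word m × Word m) × ((ℕ × List (List ℕ)) × List (Word m)) =>
    z.1.2 := Primrec.snd.comp Primrec.fst
  -- the basic relation
  have hB : PrimrecRel fun (s : Word m) (q : (ℕ × List (List ℕ)) × Word m) =>
      rho q.1 s = rho q.1 q.2 :=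
    Primrec.eq.comp (primrec_rho.comp (Primrec.fst.comp Primrec.snd) Primrec.fst)
      (primrec_rho.comp (Primrec.fst.comp Primrec.snd) (Primrec.snd.comp Primrec.snd))
  have hE := hB.exists_mem_list
  have hN : PrimrecRel fun (s : Word m) (q : (ℕ × List (List ℕ)) × Word m) =>
      ¬ rho q.1 s = rho q.1 q.2 := PrimrecPred.not hB
  have hA := hN.forall_mem_list
  refine PrimrecPred.and ?_ (PrimrecPred.and ?_ (PrimrecPred.and ?_ ?_))
  · have h1 : PrimrecRel fun (r : Word m) (c : ℕ × List (List ℕ)) =>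
        rho c r = List.range (c.1 + 1) :=
      Primrec.eq.comp (primrec_rho.comp Primrec.snd Primrec.fst)
        (Primrec.list_range.comp (Primrec.succ.comp (Primrec.fst.comp Primrec.snd)))
    exact h1.forall_mem_list.comp (Primrec.const _) hc
  · exact hE.comp hS (Primrec.pair hc hw)
  · have h1 : PrimrecRel fun (y : Fin m × Bool)
        (q : Word m × ((ℕ × List (List ℕ)) × List (Word m))) =>
        ∃ s' ∈ q.2.2, rho q.2.1 s' = rho q.2.1 (y :: (q.1 ++ [(y.1, !y.2)])) := by
      have hy : Primrec fun t : (Fin m × Bool) ×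
        (Word m × ((ℕ × List (List ℕ)) × List (Word m))) => t.1 := Primrec.fst
      have hs : Primrec fun t : (Fin m × Bool) ×
        (Word m × ((ℕ × List (List ℕ)) × List (Word m))) => t.2.1 :=
        Primrec.fst.comp Primrec.snd
      refine hE.comp (Primrec.snd.comp (Primrec.snd.comp Primrec.snd))
        (Primrec.pair (Primrec.fst.comp (Primrec.snd.comp Primrec.snd)) ?_)
      exact Primrec.list_cons.comp hy (Primrec.list_append.comp hs (Primrec.list_cons.comp
        (Primrec.pair (Primrec.fst.comp hy) (Primrec.not.comp (Primrec.snd.comp hy)))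
        (Primrec.const [])))
    have h2 : PrimrecRel fun (s : Word m) (q : (ℕ × List (List ℕ)) × List (Word m)) =>
        ∀ y ∈ yLetters Y, ∃ s' ∈ q.2, rho q.1 s' = rho q.1 (y :: (s ++ [(y.1, !y.2)])) :=
      h1.forall_mem_list.comp (f := fun _ : Word m × ((ℕ × List (List ℕ)) × List (Word m)) =>
        yLetters Y) (g := fun q => q) (Primrec.const _) Primrec.id
    exact h2.forall_mem_list.comp hS Primrec.snd
  · exact PrimrecRel.comp (R := fun (S : List (Word m)) (q : (ℕ × List (List ℕ)) × Word m) =>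
      ∀ s ∈ S, ¬ rho q.1 s = rho q.1 q.2) hA hS (Primrec.pair hc hu)

theorem eval_conj {rels : Set (FreeGroup (Fin m))} (y : Fin m × Bool) (s : Word m) :
    (evalWord (y :: (s ++ [(y.1, !y.2)])) : PresentedGroup rels) =
      evalWord [y] * evalWord s * (evalWord [y])⁻¹ := by
  obtain ⟨a, b⟩ := y
  cases b <;> simp [evalWord, mul_assoc]

theorem negCert_sound (Y : Finset (Fin m)) (u w : Word m)
    (c : (ℕ × List (List ℕ)) × List (Word m)) (h : NegCert R Y (u, w) c) :
    ¬ Good R Y (u, w) := by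
  obtain ⟨⟨n, d⟩, S⟩ := c
  obtain ⟨hv, hw, hcl, hu⟩ := h
  obtain ⟨φ, hφ⟩ := sound R hv
  have hiff := rho_eq_iff φ _ hφ
  simp only [hiff] at hw hcl hu
  rintro ⟨-, -, c, hc, he⟩
  obtain ⟨v, hv', rfl⟩ := (mem_closure_iff Y _).1 hc
  have key : ∀ v : Word m, YWord Y v → ∃ s ∈ S, φ (evalWord s) =
      φ (evalWord v * evalWord w * (evalWord v)⁻¹) := by
    intro v hv
    induction v with
    | nil => simpa [evalWord] using hw
    | cons y v ih =>
      obtain ⟨s, hs, hs'⟩ := ih fun p hp => hv p (List.mem_cons_of_mem _ hp)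
      obtain ⟨t, ht, ht'⟩ := hcl s hs y (by simpa [yLetters] using hv y List.mem_cons_self)
      refine ⟨t, ht, ?_⟩
      have e : (evalWord (y :: v) : PresentedGroup (↑R : Set (FreeGroup (Fin m)))) =
          evalWord [y] * evalWord v := evalWord_append [y] v
      rw [ht', eval_conj, e, map_mul, map_mul, hs', ← map_mul, ← map_mul]
      congr 1
      group
  obtain ⟨s, hs, hs'⟩ := key v hv'
  refine hu s hs ?_
  rw [hs']
  exact congrArg φ he.symm

theorem negCert_complete (Y : Finset (Fin m)) (u w : Word m)
    (hsep : SeparableIn {y : PresentedGroup (↑R : Set (FreeGroup (Fin m))) |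
      ∃ c ∈ Subgroup.closure (PresentedGroup.of '' (↑Y : Set (Fin m))),
        y = c * evalWord w * c⁻¹})
    (hnc : ¬ ∃ c ∈ Subgroup.closure (PresentedGroup.of '' (↑Y : Set (Fin m))),
      (evalWord u : PresentedGroup (↑R : Set (FreeGroup (Fin m)))) = c * evalWord w * c⁻¹) :
    ∃ c, NegCert R Y (u, w) c := by
  classical
  obtain ⟨N, hN, hfin, hsepN⟩ := hsep _ hnc
  let Q := PresentedGroup (↑R : Set (FreeGroup (Fin m))) ⧸ N
  have : Finite Q := Subgroup.finite_quotient_of_finiteIndex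
  obtain ⟨n, ⟨e⟩⟩ : ∃ n, Nonempty (Q ≃ Fin (n + 1)) := by
    obtain ⟨k, ⟨e⟩⟩ := Finite.exists_equiv_fin Q
    cases k with
    | zero => exact (e 1).elim0
    | succ n => exact ⟨n, ⟨e⟩⟩
  let ψ : Q →* Equiv.Perm (Fin (n + 1)) :=
    (e.permCongrHom.toMonoidHom).comp (MulAction.toPermHom Q Q)
  have hψ : Function.Injective ψ :=
    e.permCongrHom.injective.comp MulAction.toPerm_injective
  let π := QuotientGroup.mk' N
  obtain ⟨d, hd, hφ⟩ := complete R (ψ.comp π)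
  have hiff := rho_eq_iff (ψ.comp π) _ hφ
  have hiff' : ∀ a b : Word m, rho (n, d) a = rho (n, d) b ↔
      π (evalWord a) = π (evalWord b) := fun a b => by
    rw [hiff]; exact hψ.eq_iff
  have : Fintype Q := Fintype.ofFinite Q
  have hrep : ∀ q : Q, ∃ s : Word m, π (evalWord s) = q := by
    intro q
    obtain ⟨g, rfl⟩ := QuotientGroup.mk'_surjective N q
    obtain ⟨s, rfl⟩ := evalWord_surj g
    exact ⟨s, rfl⟩
  choose rep hrep using hrep
  let P : Q → Prop := fun q =>
    ∃ c ∈ Subgroup.closure (PresentedGroup.of '' (↑Y : Set (Fin m))),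
      q = π (c * evalWord w * c⁻¹)
  let S : List (Word m) := (Finset.univ.filter P).toList.map rep
  have hS : ∀ q, P q → rep q ∈ S := fun q hq =>
    List.mem_map.2 ⟨q, by simpa using hq, rfl⟩
  have hS' : ∀ s ∈ S, P (π (evalWord s)) := by
    intro s hs
    obtain ⟨q, hq, rfl⟩ := List.mem_map.1 hs
    rw [hrep]
    simpa using hq
  refine ⟨((n, d), S), hd, ?_, ?_, ?_⟩
  · refine ⟨rep (π (evalWord w)), hS _ ⟨1, one_mem _, by simp⟩, ?_⟩
    rw [hiff', hrep]
  · intro s hs y hy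
    obtain ⟨c, hc, he⟩ := hS' s hs
    refine ⟨rep (π (evalWord (y :: (s ++ [(y.1, !y.2)])))), hS _ ?_, ?_⟩
    · refine ⟨evalWord [y] * c, mul_mem ((mem_closure_iff Y _).2
        ⟨[y], by simpa [YWord, yLetters] using hy, rfl⟩) hc, ?_⟩
      rw [eval_conj, map_mul, map_mul, he, ← map_mul, ← map_mul]
      congr 1
      group
    · rw [hiff', hrep]
  · intro s hs hsu
    obtain ⟨c, hc, he⟩ := hS' s hs
    rw [hiff'] at hsu
    rw [hsu] at he
    exact hsepN _ ⟨c, hc, rfl⟩ (QuotientGroup.eq.1 he)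

theorem re_not_good (Y : Finset (Fin m))
    (hsep : ∀ h ∈ Subgroup.closure (PresentedGroup.of '' (↑Y : Set (Fin m))),
      SeparableIn {y : PresentedGroup (↑R : Set (FreeGroup (Fin m))) |
      ∃ c ∈ Subgroup.closure (PresentedGroup.of '' (↑Y : Set (Fin m))), y = c * h * c⁻¹}) :
    REPred fun x => ¬ Good R Y x := by
  have h := rePred_exists (T := fun z : (Word m × Word m) ×
      ((ℕ × List (List ℕ)) × List (Word m)) =>
      ¬ YWord Y z.1.1 ∨ ¬ YWord Y z.1.2 ∨ NegCert R Y z.1 z.2)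
    ((((primrec_YWord Y).comp (Primrec.fst.comp Primrec.fst)).not).or
      ((((primrec_YWord Y).comp (Primrec.snd.comp Primrec.fst)).not).or (primrec_negCert R Y)))
  refine h.of_eq ?_
  rintro ⟨u, w⟩
  constructor
  · rintro ⟨c, h | h | h⟩ hg
    · exact h hg.1
    · exact h hg.2.1
    · exact negCert_sound R Y u w c h hg
  · intro hg
    by_cases hu : YWord Y u
    · by_cases hw : YWord Y w
      · obtain ⟨c, hc⟩ := negCert_complete R Y u w
          (hsep _ ((mem_closure_iff Y _).2 ⟨w, hw, rfl⟩)) fun h => hg ⟨hu, hw, h⟩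
        exact ⟨c, Or.inr (Or.inr hc)⟩
      · exact ⟨default, Or.inr (Or.inl hw)⟩
    · exact ⟨default, Or.inl hu⟩

end Finite

end ConjProblem

/-- Let `G` be a finitely presented group (on generators `Fin m` with a finite set
`R` of relators) and `H` the subgroup generated by a finite subset `Y` of the
generators. If every `H`-conjugacy class of an element of `H` is separable in `G`,
then the conjugacy problem for `H` is solvable: there is a computable function
deciding whether two words in the generators from `Y` represent conjugate
elements of `H`. -/
theorem conjugacy_problem_solvable {m : ℕ} (R : Finset (FreeGroup (Fin m)))
    (Y : Finset (Fin m))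
    (H : Subgroup (PresentedGroup (↑R : Set (FreeGroup (Fin m)))))
    (hH : H = Subgroup.closure (PresentedGroup.of '' (↑Y : Set (Fin m))))
    (hsep : ∀ h ∈ H, SeparableIn {y | ∃ c ∈ H, y = c * h * c⁻¹}) :
    ∃ f : List (Fin m × Bool) → List (Fin m × Bool) → Bool, Computable₂ f ∧
      ∀ u w : List (Fin m × Bool),
        (∀ p ∈ u, p.1 ∈ Y) → (∀ p ∈ w, p.1 ∈ Y) →
        (f u w = true ↔ ∃ c ∈ H,
          evalWord (rels := (↑R : Set (FreeGroup (Fin m)))) u =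
            c * evalWord (rels := (↑R : Set (FreeGroup (Fin m)))) w * c⁻¹) := by
  subst hH
  obtain ⟨hdec, hcomp⟩ := ComputablePred.computable_iff_re_compl_re'.2
    ⟨ConjProblem.re_good R Y, ConjProblem.re_not_good R Y hsep⟩
  refine ⟨fun u w => decide (ConjProblem.Good R Y (u, w)), hcomp, ?_⟩
  intro u w hu hw
  rw [decide_eq_true_iff]
  exact ⟨fun h => h.2.2, fun h => ⟨hu, hw, h⟩⟩
end
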